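/- Let λ₁, λ₂ ∈ ℝ and Ξ = {(ξ,η) ∈ ℝ² : 0 ≤ ξ ≤ 2, 0 ≤ η ≤ min(ξ, 2−ξ)}. Suppose (G₁, H₁) and (G₂, H₂) are two pairs of continuous functions on Ξ, each satisfying the integral equations G(ξ,η) = (λ₂/2) ∫₀^η ∫₀^τ H(τ,s) ds dτ + (λ₂/4) ∫_η^ξ ∫₀^η H(τ,s) ds dτ and H(ξ,η) = −(λ₁/4)(ξ+η) + (λ₁/2) ∫₀^η ∫₀^τ G(τ,s) ds dτ + (λ₁/4) ∫_η^ξ ∫₀^η G(τ,s) ds dτ for all (ξ,η) ∈ Ξ. Then G₁ = G₂ and H₁ = H₂ on Ξ. -/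

import Mathlib

open MeasureTheory Set

/-- The characteristic-coordinate domain `Ξ = {(ξ,η) : 0 ≤ ξ ≤ 2, 0 ≤ η ≤ min(ξ, 2−ξ)}`. -/
def XiDom : Set (ℝ × ℝ) :=
  {p : ℝ × ℝ | 0 ≤ p.1 ∧ p.1 ≤ 2 ∧ 0 ≤ p.2 ∧ p.2 ≤ min p.1 (2 - p.1)}

/-- Predicate: `(G,H)` is a continuous solution of the kernel integral equations on `Ξ`. -/
def SolvesKernelIE (l1 l2 : ℝ) (G H : ℝ → ℝ → ℝ) : Prop :=
  ContinuousOn (fun p : ℝ × ℝ => G p.1 p.2) XiDom ∧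
  ContinuousOn (fun p : ℝ × ℝ => H p.1 p.2) XiDom ∧
  (∀ p ∈ XiDom,
    G p.1 p.2 =
      (l2 / 2) * (∫ τ in (0:ℝ)..p.2, ∫ s in (0:ℝ)..τ, H τ s) +
        (l2 / 4) * ∫ τ in p.2..p.1, ∫ s in (0:ℝ)..p.2, H τ s) ∧
  (∀ p ∈ XiDom,
    H p.1 p.2 =
      -(l1 / 4) * (p.1 + p.2) +
        (l1 / 2) * (∫ τ in (0:ℝ)..p.2, ∫ s in (0:ℝ)..τ, G τ s) +
          (l1 / 4) * ∫ τ in p.2..p.1, ∫ s in (0:ℝ)..p.2, G τ s)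

/-- The integral operator common to both kernel equations. -/
noncomputable def kernelOp (F : ℝ → ℝ → ℝ) (p : ℝ × ℝ) : ℝ :=
  (1 / 2) * (∫ τ in (0:ℝ)..p.2, ∫ s in (0:ℝ)..τ, F τ s) +
    (1 / 4) * ∫ τ in p.2..p.1, ∫ s in (0:ℝ)..p.2, F τ s

theorem mem_XiDom_iff {x y : ℝ} : (x, y) ∈ XiDom ↔ 0 ≤ y ∧ y ≤ x ∧ x + y ≤ 2 := by
  simp only [XiDom, mem_ofPred_eq, le_min_iff]
  constructor
  · rintro ⟨-, -, h1, h2, h3⟩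
    exact ⟨h1, h2, by linarith⟩
  · rintro ⟨h1, h2, h3⟩
    exact ⟨by linarith, by linarith, h1, h2, by linarith⟩

theorem isCompact_XiDom : IsCompact XiDom := by
  refine (isCompact_Icc (a := ((0, 0) : ℝ × ℝ)) (b := (2, 2))).of_isClosed_subset ?_ ?_
  · have h : XiDom = {p : ℝ × ℝ | 0 ≤ p.2} ∩ ({p | p.2 ≤ p.1} ∩ {p | p.1 + p.2 ≤ 2}) := by
      ext ⟨x, y⟩
      exact mem_XiDom_iff
    rw [h]
    exact (isClosed_le (by fun_prop) (by fun_prop)).inter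
      ((isClosed_le (by fun_prop) (by fun_prop)).inter (isClosed_le (by fun_prop) (by fun_prop)))
  · rintro ⟨x, y⟩ h
    obtain ⟨h1, h2, h3⟩ := mem_XiDom_iff.1 h
    simp only [mem_Icc, Prod.mk_le_mk]
    refine ⟨⟨?_, ?_⟩, ?_, ?_⟩ <;> linarith

theorem exists_continuous_eq_on_XiDom {F : ℝ → ℝ → ℝ}
    (hF : ContinuousOn (fun p : ℝ × ℝ => F p.1 p.2) XiDom) :
    ∃ F' : ℝ → ℝ → ℝ, Continuous (fun p : ℝ × ℝ => F' p.1 p.2) ∧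
      ∀ x y, (x, y) ∈ XiDom → F x y = F' x y := by
  let c : ℝ → ℝ := fun x => max 0 (min x 2)
  let d : ℝ → ℝ → ℝ := fun x y => max 0 (min y (min (c x) (2 - c x)))
  refine ⟨fun x y => F (c x) (d x y), ?_, ?_⟩
  · refine hF.comp_continuous (f := fun p : ℝ × ℝ => (c p.1, d p.1 p.2))
      (by simp only [c, d]; fun_prop) fun p => ?_
    have h0 : 0 ≤ c p.1 := le_max_left _ _
    have h2 : c p.1 ≤ 2 := max_le (by norm_num) (min_le_right _ _)
    exact ⟨h0, h2, le_max_left _ _,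
      max_le (le_min h0 (by linarith)) (min_le_right _ _)⟩
  · rintro x y ⟨h1, h2, h3, h4⟩
    have hc : c x = x := by simp only [c]; rw [min_eq_left h2, max_eq_right h1]
    have hd : d x y = y := by simp only [d]; rw [hc, min_eq_left h4, max_eq_right h3]
    simp only [hc, hd]

theorem mem_XiDom_of_le_of_le {ξ η τ s : ℝ} (hp : (ξ, η) ∈ XiDom)
    (hτ : τ ≤ η) (hs0 : 0 ≤ s) (hs : s ≤ τ) : (τ, s) ∈ XiDom := by
  obtain ⟨h1, h2, h3⟩ := mem_XiDom_iff.1 hp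
  exact mem_XiDom_iff.2 ⟨hs0, hs, by linarith⟩

theorem mem_XiDom_of_mem_rect {ξ η τ s : ℝ} (hp : (ξ, η) ∈ XiDom)
    (hτ : η ≤ τ) (hτ' : τ ≤ ξ) (hs0 : 0 ≤ s) (hs : s ≤ η) : (τ, s) ∈ XiDom := by
  obtain ⟨h1, h2, h3⟩ := mem_XiDom_iff.1 hp
  exact mem_XiDom_iff.2 ⟨hs0, by linarith, by linarith⟩

theorem kernelOp_congr {F F' : ℝ → ℝ → ℝ} (h : ∀ x y, (x, y) ∈ XiDom → F x y = F' x y)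
    {p : ℝ × ℝ} (hp : p ∈ XiDom) : kernelOp F p = kernelOp F' p := by
  obtain ⟨ξ, η⟩ := p
  obtain ⟨h1, h2, h3⟩ := mem_XiDom_iff.1 hp
  simp only [kernelOp]
  congr 2
  · refine intervalIntegral.integral_congr fun τ hτ => ?_
    rw [uIcc_of_le h1] at hτ
    refine intervalIntegral.integral_congr fun s hs => ?_
    rw [uIcc_of_le hτ.1] at hs
    exact h _ _ (mem_XiDom_of_le_of_le hp hτ.2 hs.1 hs.2)
  · refine intervalIntegral.integral_congr fun τ hτ => ?_
    rw [uIcc_of_le h2] at hτ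
    refine intervalIntegral.integral_congr fun s hs => ?_
    rw [uIcc_of_le h1] at hs
    exact h _ _ (mem_XiDom_of_mem_rect hp hτ.1 hτ.2 hs.1 hs.2)

theorem kernelOp_sub_of_continuous {F F' : ℝ → ℝ → ℝ}
    (hF : Continuous (fun p : ℝ × ℝ => F p.1 p.2))
    (hF' : Continuous (fun p : ℝ × ℝ => F' p.1 p.2)) (p : ℝ × ℝ) :
    kernelOp (fun x y => F x y - F' x y) p = kernelOp F p - kernelOp F' p := by
  have hsec {f : ℝ → ℝ → ℝ} (hf : Continuous (fun p : ℝ × ℝ => f p.1 p.2)) (τ a b : ℝ) :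
      IntervalIntegrable (fun s => f τ s) volume a b :=
    (hf.comp (by fun_prop : Continuous fun s : ℝ => (τ, s))).intervalIntegrable _ _
  have hint {f : ℝ → ℝ → ℝ} (hf : Continuous (fun p : ℝ × ℝ => f p.1 p.2)) {b : ℝ → ℝ}
      (hb : Continuous b) (a a' : ℝ) :
      IntervalIntegrable (fun τ => ∫ s in (0:ℝ)..b τ, f τ s) volume a a' :=
    (intervalIntegral.continuous_parametric_intervalIntegral_of_continuous
      (f := f) hf hb).intervalIntegrable _ _
  simp only [kernelOp]
  simp_rw [fun τ a b => intervalIntegral.integral_sub (hsec hF τ a b) (hsec hF' τ a b)]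
  rw [intervalIntegral.integral_sub (hint hF continuous_id' _ _) (hint hF' continuous_id' _ _),
    intervalIntegral.integral_sub (hint hF continuous_const _ _) (hint hF' continuous_const _ _)]
  ring

theorem kernelOp_sub {F F' : ℝ → ℝ → ℝ}
    (hF : ContinuousOn (fun p : ℝ × ℝ => F p.1 p.2) XiDom)
    (hF' : ContinuousOn (fun p : ℝ × ℝ => F' p.1 p.2) XiDom) {p : ℝ × ℝ} (hp : p ∈ XiDom) :
    kernelOp (fun x y => F x y - F' x y) p = kernelOp F p - kernelOp F' p := by
  obtain ⟨E, hE, hFE⟩ := exists_continuous_eq_on_XiDom hF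
  obtain ⟨E', hE', hFE'⟩ := exists_continuous_eq_on_XiDom hF'
  rw [kernelOp_congr hFE hp, kernelOp_congr hFE' hp, ← kernelOp_sub_of_continuous hE hE' p]
  exact kernelOp_congr (fun x y h => by rw [hFE x y h, hFE' x y h]) hp

theorem abs_integral_le_of_le_pow {f : ℝ → ℝ} {C b : ℝ} {n : ℕ} (hb : 0 ≤ b)
    (h : ∀ s, 0 ≤ s → s ≤ b → |f s| ≤ C * s ^ n) :
    |∫ s in (0:ℝ)..b, f s| ≤ C * (b ^ (n + 1) / (n + 1)) := by
  have := intervalIntegral.norm_integral_le_of_norm_le (f := f) (g := fun s => C * s ^ n)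
    (μ := volume) hb (Filter.Eventually.of_forall fun s hs => h s hs.1.le hs.2)
    ((by fun_prop : Continuous fun s : ℝ => C * s ^ n).intervalIntegrable _ _)
  simpa [integral_pow] using this

theorem abs_kernelOp_le {F : ℝ → ℝ → ℝ} {C : ℝ} {n : ℕ} (hC : 0 ≤ C)
    (h : ∀ x y, (x, y) ∈ XiDom → |F x y| ≤ C * y ^ n) {ξ η : ℝ} (hp : (ξ, η) ∈ XiDom) :
    |kernelOp F (ξ, η)| ≤ C * (η ^ (n + 1) / (n + 1)) := by
  obtain ⟨h1, h2, h3⟩ := mem_XiDom_iff.1 hp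
  set B := C * (η ^ (n + 1) / (n + 1)) with hB
  have hB0 : 0 ≤ B := by positivity
  have hI : ‖∫ τ in (0:ℝ)..η, ∫ s in (0:ℝ)..τ, F τ s‖ ≤ B * |η - 0| := by
    refine intervalIntegral.norm_integral_le_of_norm_le_const fun τ hτ => ?_
    rw [uIoc_of_le h1] at hτ
    refine (abs_integral_le_of_le_pow hτ.1.le fun s hs0 hs =>
      h _ _ (mem_XiDom_of_le_of_le hp hτ.2 hs0 hs)).trans ?_
    have := hτ.1.le
    have := hτ.2
    rw [hB]
    gcongr
  have hJ : ‖∫ τ in η..ξ, ∫ s in (0:ℝ)..η, F τ s‖ ≤ B * |ξ - η| := by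
    refine intervalIntegral.norm_integral_le_of_norm_le_const fun τ hτ => ?_
    rw [uIoc_of_le h2] at hτ
    exact abs_integral_le_of_le_pow h1 fun s hs0 hs =>
      h _ _ (mem_XiDom_of_mem_rect hp hτ.1.le hτ.2 hs0 hs)
  rw [Real.norm_eq_abs, sub_zero, abs_of_nonneg h1] at hI
  rw [Real.norm_eq_abs, abs_of_nonneg (sub_nonneg.2 h2)] at hJ
  have hI' : B * η ≤ B * 1 := by gcongr; linarith
  have hJ' : B * (ξ - η) ≤ B * 2 := by gcongr; linarith
  rw [abs_le] at hI hJ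
  simp only [kernelOp]
  rw [abs_le]
  constructor <;> linarith [hI.1, hI.2, hJ.1, hJ.2]

theorem SolvesKernelIE.left_eq {l1 l2 : ℝ} {G H : ℝ → ℝ → ℝ} (h : SolvesKernelIE l1 l2 G H)
    {p : ℝ × ℝ} (hp : p ∈ XiDom) : G p.1 p.2 = l2 * kernelOp H p := by
  rw [h.2.2.1 p hp, kernelOp]
  ring

theorem SolvesKernelIE.right_eq {l1 l2 : ℝ} {G H : ℝ → ℝ → ℝ} (h : SolvesKernelIE l1 l2 G H)
    {p : ℝ × ℝ} (hp : p ∈ XiDom) :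
    H p.1 p.2 = -(l1 / 4) * (p.1 + p.2) + l1 * kernelOp G p := by
  rw [h.2.2.2 p hp, kernelOp]
  ring

/-- A pair of bounded functions solving the homogeneous kernel equations decays factorially. -/
theorem abs_le_pow_div_factorial_of_homogeneous {l1 l2 M : ℝ} {g h : ℝ → ℝ → ℝ} (hM : 0 ≤ M)
    (hg : ∀ x y, (x, y) ∈ XiDom → |g x y| ≤ M) (hh : ∀ x y, (x, y) ∈ XiDom → |h x y| ≤ M)
    (hgh : ∀ x y, (x, y) ∈ XiDom → g x y = l2 * kernelOp h (x, y))
    (hhg : ∀ x y, (x, y) ∈ XiDom → h x y = l1 * kernelOp g (x, y)) (n : ℕ) :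
    ∀ x y, (x, y) ∈ XiDom →
      |g x y| ≤ M * ((|l1| + |l2|) ^ n / n.factorial) * y ^ n ∧
      |h x y| ≤ M * ((|l1| + |l2|) ^ n / n.factorial) * y ^ n := by
  induction n with
  | zero => exact fun x y hp => by simpa using ⟨hg x y hp, hh x y hp⟩
  | succ n ih =>
    intro x y hp
    have hy : 0 ≤ y := (mem_XiDom_iff.1 hp).1
    have hC : 0 ≤ M * ((|l1| + |l2|) ^ n / n.factorial) := by positivity
    have key {l : ℝ} {f : ℝ → ℝ → ℝ} (hl : |l| ≤ |l1| + |l2|)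
        (hf : ∀ x y, (x, y) ∈ XiDom →
          |f x y| ≤ M * ((|l1| + |l2|) ^ n / n.factorial) * y ^ n) :
        |l * kernelOp f (x, y)| ≤
          M * ((|l1| + |l2|) ^ (n + 1) / (n + 1).factorial) * y ^ (n + 1) := by
      rw [abs_mul]
      calc |l| * |kernelOp f (x, y)|
          ≤ (|l1| + |l2|) *
            (M * ((|l1| + |l2|) ^ n / n.factorial) * (y ^ (n + 1) / (n + 1))) := by
            gcongr
            exact abs_kernelOp_le hC hf hp
        _ = _ := by
            rw [Nat.factorial_succ]
            push_cast
            field_simp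
            ring
    rw [hgh x y hp, hhg x y hp]
    exact ⟨key (le_add_of_nonneg_left (abs_nonneg _)) fun x y hp => (ih x y hp).2,
      key (le_add_of_nonneg_right (abs_nonneg _)) fun x y hp => (ih x y hp).1⟩

theorem eq_zero_of_abs_le_pow_div_factorial {a M L y : ℝ}
    (h : ∀ n : ℕ, |a| ≤ M * (L ^ n / n.factorial) * y ^ n) : a = 0 := by
  have ht : Filter.Tendsto (fun n : ℕ => M * ((L * y) ^ n / n.factorial)) Filter.atTop
      (nhds (M * 0)) :=
    (FloorSemiring.tendsto_pow_div_factorial_atTop (L * y)).const_mul M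
  rw [mul_zero] at ht
  refine abs_nonpos_iff.1 (ge_of_tendsto' ht fun n => (h n).trans_eq ?_)
  rw [mul_pow]
  ring

/-- uniqueness of continuous solutions of the kernel integral equations. -/
theorem kernel_integral_equations_uniqueness
    (l1 l2 : ℝ) (G1 H1 G2 H2 : ℝ → ℝ → ℝ)
    (h1 : SolvesKernelIE l1 l2 G1 H1) (h2 : SolvesKernelIE l1 l2 G2 H2) :
    ∀ p ∈ XiDom, G1 p.1 p.2 = G2 p.1 p.2 ∧ H1 p.1 p.2 = H2 p.1 p.2 := by
  obtain ⟨A, hA⟩ := isCompact_XiDom.exists_bound_of_continuousOn (h1.1.sub h2.1)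
  obtain ⟨B, hB⟩ := isCompact_XiDom.exists_bound_of_continuousOn (h1.2.1.sub h2.2.1)
  have key := abs_le_pow_div_factorial_of_homogeneous (l1 := l1) (l2 := l2)
    (M := max 0 (max A B))
    (g := fun x y => G1 x y - G2 x y) (h := fun x y => H1 x y - H2 x y) (le_max_left _ _)
    (fun x y hp => (hA (x, y) hp).trans ((le_max_left _ _).trans (le_max_right _ _)))
    (fun x y hp => (hB (x, y) hp).trans ((le_max_right _ _).trans (le_max_right _ _)))
    (fun x y hp => by
      rw [kernelOp_sub h1.2.1 h2.2.1 hp, mul_sub, ← h1.left_eq hp, ← h2.left_eq hp])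
    (fun x y hp => by
      rw [kernelOp_sub h1.1 h2.1 hp]
      linear_combination h1.right_eq hp - h2.right_eq hp)
  rintro ⟨x, y⟩ hp
  exact ⟨sub_eq_zero.1 (eq_zero_of_abs_le_pow_div_factorial fun n => (key n x y hp).1),
    sub_eq_zero.1 (eq_zero_of_abs_le_pow_div_factorial fun n => (key n x y hp).2)⟩
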